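/- arXiv:2605.00947 — 2 statements merged into one kernel-verified Lean document; each statement's English description precedes it below -/
import Mathlib

section
/- The set of boundary instances of the Affine Universal Escape Problem has Lebesgue measure zero; that is, the topological frontier (boundary) of the set {(A, b, B, η) ∈ ℝ^{n×n} × ℝⁿ × ℝ^{m×n} × ℝ^m : (A, b, B, η) is escaping} has Lebesgue measure zero in ℝ^{n×n} × ℝⁿ × ℝ^{m×n} × ℝ^m. -/
open MeasureTheory

noncomputable instance matrixMeasureSpace (a b : ℕ) :
    MeasureSpace (Matrix (Fin a) (Fin b) ℝ) :=
  inferInstanceAs (MeasureSpace (Fin a → Fin b → ℝ))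

/-- The affine instance `(A, b, B, η)` is trapped if some point of the polyhedron
`P(B, η) = {x : B x ⊳ η}` stays in `P(B, η)` forever under iteration of
`f(x) = A x + b`. -/
def IsTrappedAff {n m : ℕ} (A : Matrix (Fin n) (Fin n) ℝ) (b : Fin n → ℝ)
    (B : Matrix (Fin m) (Fin n) ℝ) (η : Fin m → ℝ) : Prop :=
  ∃ x : Fin n → ℝ, ∀ k : ℕ, ∀ j : Fin m,
    η j < B.mulVec ((fun y => A.mulVec y + b)^[k] x) j

open Filter Topology Set Polynomial

theorem measure_zeroSet_eq_zero_of_polynomial_on_lines {E : Type*} [NormedAddCommGroup E]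
    [NormedSpace ℝ E] [FiniteDimensional ℝ E] [MeasurableSpace E] [BorelSpace E]
    (μ : Measure E) [μ.IsAddHaarMeasure] {g : E → ℝ} (hg : Continuous g) (x₀ : E)
    (h₀ : g x₀ ≠ 0) (hp : ∀ x, ∃ p : ℝ[X], ∀ t : ℝ, g (x₀ + t • x) = p.eval t) :
    μ {x | g x = 0} = 0 := by
  have hW : MeasurableSet {w : ℝ × E | g (x₀ + w.1 • w.2) = 0} :=
    (isClosed_singleton.preimage
      (f := fun w : ℝ × E => g (x₀ + w.1 • w.2)) (by fun_prop)).measurableSet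
  have hnull : (μ.prod volume) {w : E × ℝ | g (x₀ + w.2 • w.1) = 0} = 0 := by
    refine (Measure.measure_prod_null (measurable_swap hW)).2 (Eventually.of_forall fun x => ?_)
    obtain ⟨p, hp⟩ := hp x
    have hp0 : p ≠ 0 := by
      rintro rfl
      exact h₀ (by simpa using hp 0)
    refine (Set.Finite.subset (p.roots.toFinset.finite_toSet) fun t ht => ?_).measure_zero _
    have ht' : g (x₀ + t • x) = 0 := ht
    rw [hp] at ht'
    simpa [hp0] using ht'
  have hnull' : ((volume : Measure ℝ).prod μ) {w : ℝ × E | g (x₀ + w.1 • w.2) = 0} = 0 := by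
    rw [← Measure.prod_swap, Measure.map_apply measurable_swap hW]
    exact hnull
  have hae := (Measure.measure_prod_null hW).1 hnull'
  have hne : ∀ᵐ c : ℝ, c ≠ 0 := by simp [ae_iff]
  obtain ⟨c, hc, hc0⟩ := (hae.and hne).exists
  have h1 : μ ((c • ·) ⁻¹' ((x₀ + ·) ⁻¹' {x | g x = 0})) = 0 := hc
  rw [Measure.addHaar_preimage_smul _ hc0, measure_preimage_add] at h1
  simpa [hc0] using h1
section
variable {E : Type*} [NormedAddCommGroup E] [NormedSpace ℝ E]

/-- The rescaled resolvent `(r - 1) (r - A)⁻¹` is defined on `C` and maps `C` into itself. -/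
def ResolventInvariant (A : E →L[ℝ] E) (C : Set E) (r : ℝ) : Prop :=
  ∀ y ∈ C, ∃ z ∈ C, r • z - A z = (r - 1) • y

theorem exists_mem_eq_of_contracting [CompleteSpace E] {C : Set E}
    (hC : IsClosed C) {L : E →L[ℝ] E} {u : E} {y : E} (hy : y ∈ C)
    (hL : ‖L‖ < 1) (hmaps : ∀ z ∈ C, L z + u ∈ C) : ∃ z ∈ C, L z + u = z := by
  have hlip : LipschitzWith ‖L‖₊ (fun z => L z + u) := by
    refine LipschitzWith.of_dist_le_mul fun a b => ?_
    rw [dist_add_right]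
    exact L.lipschitz.dist_le_mul a b
  have hm : MapsTo (fun z => L z + u) C C := hmaps
  have hc : ContractingWith ‖L‖₊ (hm.restrict (fun z => L z + u) C C) :=
    ContractingWith.restrict ⟨by exact_mod_cast hL, hlip⟩ hm
  obtain ⟨z, hz, hz', -⟩ := hc.exists_fixedPoint' hC.isComplete hm hy (edist_ne_top _ _)
  exact ⟨z, hz, hz'⟩

theorem resolventInvariant_of_norm_lt [CompleteSpace E] {A : E →L[ℝ] E} {C : Set E}
    (hC : IsClosed C) (hconv : Convex ℝ C) (hA : ∀ y ∈ C, A y ∈ C) {r : ℝ} (hr : 1 < r)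
    (hAr : ‖A‖ < r) : ResolventInvariant A C r := by
  intro y hy
  have hr0 : 0 < r := by linarith
  obtain ⟨z, hz, hz'⟩ := exists_mem_eq_of_contracting (L := r⁻¹ • A) (u := (1 - r⁻¹) • y) hC hy
    (by rw [norm_smul, norm_inv, Real.norm_of_nonneg hr0.le, inv_mul_lt_iff₀ hr0]; simpa)
    (fun z hz => hconv (hA z hz) hy (by positivity)
      (by simpa using inv_le_one_of_one_le₀ hr.le) (by ring))
  refine ⟨z, hz, ?_⟩
  have h2 := congrArg (r • ·) hz'
  simp only [smul_add, smul_smul, smul_apply, mul_inv_cancel₀ hr0.ne',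
    mul_sub, one_smul, mul_one] at h2
  rw [← h2]
  abel

theorem ResolventInvariant.exists_lt [FiniteDimensional ℝ E] {A : E →L[ℝ] E} {C : Set E}
    (hC : IsClosed C) (hconv : Convex ℝ C) (hspan : Submodule.span ℝ C = ⊤) {r₀ : ℝ}
    (hr₀ : 1 < r₀) (h : ResolventInvariant A C r₀) :
    ∃ δ > 0, ∀ r, 1 < r → r₀ - δ < r → r ≤ r₀ → ResolventInvariant A C r := by
  have : CompleteSpace E := FiniteDimensional.complete ℝ E
  let S : E →ₗ[ℝ] E := r₀ • LinearMap.id - A.toLinearMap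
  have hS : ∀ z, S z = r₀ • z - A z := fun z => rfl
  have hsurj : Function.Surjective S := by
    rw [← LinearMap.range_eq_top, eq_top_iff, ← hspan, Submodule.span_le]
    intro y hy
    obtain ⟨z, -, hz⟩ := h y hy
    refine ⟨(r₀ - 1)⁻¹ • z, ?_⟩
    rw [map_smul, hS, hz, smul_smul, inv_mul_cancel₀ (by linarith), one_smul]
  have hinj : Function.Injective S := LinearMap.injective_iff_surjective.2 hsurj
  let e := (LinearEquiv.ofBijective S ⟨hinj, hsurj⟩).toContinuousLinearEquiv
  let R : E →L[ℝ] E := e.symm.toContinuousLinearMap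
  have hRS : ∀ z, R (r₀ • z - A z) = z := fun z => e.symm_apply_apply z
  have hSR : ∀ z, r₀ • R z - A (R z) = z := fun z => e.apply_symm_apply z
  refine ⟨(‖R‖ + 1)⁻¹, by positivity, fun r hr hrδ hrr y hy => ?_⟩
  obtain ⟨z, hz, hz'⟩ := exists_mem_eq_of_contracting (L := (r₀ - r) • R)
    (u := R ((r - 1) • y)) hC hy
    (by
      rw [norm_smul, Real.norm_of_nonneg (by linarith)]
      calc (r₀ - r) * ‖R‖ ≤ (r₀ - r) * (‖R‖ + 1) := by gcongr; linarith
        _ < (‖R‖ + 1)⁻¹ * (‖R‖ + 1) := by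
          have := norm_nonneg R
          gcongr; linarith
        _ = 1 := inv_mul_cancel₀ (by positivity))
    (fun z hz => by
      have hpos : 0 < r₀ - 1 := by linarith
      obtain ⟨w, hw, hw'⟩ := h (((r₀ - r) / (r₀ - 1)) • z + ((r - 1) / (r₀ - 1)) • y)
        (hconv hz hy (div_nonneg (by linarith) hpos.le) (div_nonneg (by linarith) hpos.le)
          (by field_simp; ring))
      have : (r₀ - 1) • (((r₀ - r) / (r₀ - 1)) • z + ((r - 1) / (r₀ - 1)) • y) =
          (r₀ - r) • z + (r - 1) • y := by
        rw [smul_add, smul_smul, smul_smul, mul_div_cancel₀ _ hpos.ne',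
          mul_div_cancel₀ _ hpos.ne']
      rw [this] at hw'
      have h3 := hRS w
      rw [hw', map_add, map_smul] at h3
      rw [smul_apply, h3]
      exact hw)
  refine ⟨z, hz, ?_⟩
  have h4 := hSR ((r₀ - r) • z + (r - 1) • y)
  rw [map_add, map_smul] at h4
  rw [smul_apply] at hz'
  rw [hz'] at h4
  have : r • z - A z = (r₀ • z - A z) - (r₀ - r) • z := by rw [sub_smul]; abel
  rw [this, h4]
  abel

/-- `v` is a nonzero vector along which every functional bounded below on `C` is nonnegative. -/
def IsAsymptoticDirection (C : Set E) (v : E) : Prop :=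
  v ≠ 0 ∧ ∀ (φ : E →L[ℝ] ℝ) (c : ℝ), (∀ z ∈ C, c ≤ φ z) → 0 ≤ φ v

theorem exists_eigenvector_of_tendsto_norm_atTop [FiniteDimensional ℝ E] {A : E →L[ℝ] E}
    {C : Set E} {ρ : ℝ} {r : ℕ → ℝ} (hr : Tendsto r atTop (𝓝 ρ)) {y : E} {z : ℕ → E}
    (hzC : ∀ n, z n ∈ C) (hz : ∀ n, r n • z n - A (z n) = (r n - 1) • y)
    (hinf : Tendsto (fun n => ‖z n‖) atTop atTop) :
    ∃ v, IsAsymptoticDirection C v ∧ A v = ρ • v := by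
  have hbd : ∃ᶠ n in atTop, (‖z n‖⁻¹ • z n) ∈ Metric.closedBall (0 : E) 1 := by
    refine (Eventually.of_forall fun n => ?_).frequently
    rw [mem_closedBall_zero_iff, norm_smul, norm_inv, norm_norm]
    exact inv_mul_le_one
  have : ProperSpace E := FiniteDimensional.proper ℝ E
  obtain ⟨v, -, ψ, hψ, hv⟩ :=
    tendsto_subseq_of_frequently_bounded Metric.isBounded_closedBall hbd
  have hψt := hψ.tendsto_atTop
  have hinv : Tendsto (fun n => ‖z (ψ n)‖⁻¹) atTop (𝓝 0) :=
    tendsto_inv_atTop_zero.comp (hinf.comp hψt)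
  have hrψ : Tendsto (fun n => r (ψ n)) atTop (𝓝 ρ) := hr.comp hψt
  refine ⟨v, ⟨?_, fun φ c hφ => ?_⟩, ?_⟩
  · rintro rfl
    have h1 : Tendsto (fun n => ‖‖z (ψ n)‖⁻¹ • z (ψ n)‖) atTop (𝓝 0) := by
      simpa using hv.norm
    have h2 : Tendsto (fun n => ‖‖z (ψ n)‖⁻¹ • z (ψ n)‖) atTop (𝓝 1) := by
      refine tendsto_const_nhds.congr' ?_
      filter_upwards [hψt.eventually (hinf.eventually_gt_atTop 0)] with n hn
      rw [norm_smul, norm_inv, norm_norm, inv_mul_cancel₀ (ne_of_gt hn)]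
    exact zero_ne_one (tendsto_nhds_unique h1 h2)
  · have h1 : Tendsto (fun n => φ (‖z (ψ n)‖⁻¹ • z (ψ n))) atTop (𝓝 (φ v)) :=
      (φ.continuous.tendsto v).comp hv
    have h2 : Tendsto (fun n => ‖z (ψ n)‖⁻¹ * c) atTop (𝓝 0) := by
      simpa using hinv.mul_const c
    refine le_of_tendsto_of_tendsto' h2 h1 fun n => ?_
    rw [map_smul, smul_eq_mul]
    exact mul_le_mul_of_nonneg_left (hφ _ (hzC _)) (by positivity)
  · have h1 : Tendsto (fun n => A (‖z (ψ n)‖⁻¹ • z (ψ n))) atTop (𝓝 (A v)) :=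
      (A.continuous.tendsto v).comp hv
    have h2 : Tendsto (fun n => r (ψ n) • (‖z (ψ n)‖⁻¹ • z (ψ n)) -
        ‖z (ψ n)‖⁻¹ • ((r (ψ n) - 1) • y)) atTop (𝓝 (ρ • v - (0 : ℝ) • ((ρ - 1) • y))) :=
      (hrψ.smul hv).sub (hinv.smul ((hrψ.sub_const 1).smul_const y))
    rw [zero_smul, sub_zero] at h2
    refine tendsto_nhds_unique h1 (h2.congr fun n => ?_)
    rw [← hz, smul_sub, map_smul, smul_comm (r (ψ n))]
    abel

theorem exists_fixedPoint_or_eigenvector_of_span_eq_top [FiniteDimensional ℝ E] {A : E →L[ℝ] E}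
    {C : Set E} (hC : IsClosed C) (hconv : Convex ℝ C) (hA : ∀ y ∈ C, A y ∈ C)
    (hne : C.Nonempty) (hspan : Submodule.span ℝ C = ⊤) :
    (∃ z ∈ C, A z = z) ∨ ∃ r : ℝ, 1 ≤ r ∧ ∃ v, IsAsymptoticDirection C v ∧ A v = r • v := by
  have : CompleteSpace E := FiniteDimensional.complete ℝ E
  have : ProperSpace E := FiniteDimensional.proper ℝ E
  let S : Set ℝ := {r | 1 ≤ r ∧ ∀ s, r < s → ResolventInvariant A C s}
  have hSne : S.Nonempty := ⟨max 1 ‖A‖, le_max_left _ _, fun s hs =>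
    resolventInvariant_of_norm_lt hC hconv hA ((le_max_left _ _).trans_lt hs)
      ((le_max_right _ _).trans_lt hs)⟩
  have hSbdd : BddBelow S := ⟨1, fun r hr => hr.1⟩
  set ρ := sInf S
  have hρ1 : 1 ≤ ρ := le_csInf hSne fun r hr => hr.1
  have hρ : ∀ s, ρ < s → ResolventInvariant A C s := fun s hs => by
    obtain ⟨r, hr, hrs⟩ := exists_lt_of_csInf_lt hSne hs
    exact hr.2 s hrs
  by_cases hex : ∃ v, IsAsymptoticDirection C v ∧ A v = ρ • v
  · exact Or.inr ⟨ρ, hρ1, hex⟩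
  left
  let r : ℕ → ℝ := fun n => ρ + 1 / ((n : ℝ) + 1)
  have hrt : Tendsto r atTop (𝓝 ρ) := by
    simpa [r] using (tendsto_one_div_add_atTop_nhds_zero_nat (𝕜 := ℝ)).const_add ρ
  have hinvρ : ResolventInvariant A C ρ := by
    intro y hy
    choose z hzC hz using fun n : ℕ =>
      hρ (r n) (lt_add_of_pos_right ρ Nat.one_div_pos_of_nat) y hy
    have hnot : ¬ Tendsto (fun n => ‖z n‖) atTop atTop := fun hinf =>
      hex (exists_eigenvector_of_tendsto_norm_atTop hrt hzC hz hinf)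
    obtain ⟨M, hM⟩ : ∃ M, ∃ᶠ n in atTop, ‖z n‖ < M := by
      simpa [tendsto_atTop, Filter.Frequently, not_forall] using hnot
    obtain ⟨w, -, ψ, hψ, hw⟩ := tendsto_subseq_of_frequently_bounded (x := z)
      (Metric.isBounded_ball (x := (0 : E)) (r := M)) (by simpa using hM)
    refine ⟨w, hC.mem_of_tendsto hw (Eventually.of_forall fun n => hzC _), ?_⟩
    have hrψ : Tendsto (fun n => r (ψ n)) atTop (𝓝 ρ) := hrt.comp hψ.tendsto_atTop
    have h1 := (hrψ.smul hw).sub ((A.continuous.tendsto w).comp hw)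
    have h2 := (hrψ.sub_const 1).smul_const y
    exact tendsto_nhds_unique (h1.congr fun n => hz (ψ n)) h2
  rcases hρ1.eq_or_lt with h1 | h1
  · obtain ⟨y, hy⟩ := hne
    obtain ⟨z, hz, hz'⟩ := hinvρ y hy
    refine ⟨z, hz, ?_⟩
    rw [← h1] at hz'
    simpa [sub_eq_zero, eq_comm (a := z)] using hz'
  · obtain ⟨δ, hδ, hδ'⟩ := hinvρ.exists_lt hC hconv hspan h1
    have hlt : max 1 (ρ - δ) < ρ := max_lt h1 (by linarith)
    have : max 1 (ρ - δ) ∈ S := by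
      refine ⟨le_max_left _ _, fun s hs => ?_⟩
      rcases le_or_gt s ρ with h | h
      · exact hδ' s ((le_max_left _ _).trans_lt hs) ((le_max_right _ _).trans_lt hs) h
      · exact hρ s h
    exact absurd (csInf_le hSbdd this) (not_le.2 hlt)

/-- A closed convex set invariant under a linear map contains a fixed point, unless the map
has an eigenvector with eigenvalue at least one pointing to infinity in the set. -/
theorem exists_fixedPoint_or_eigenvector [FiniteDimensional ℝ E] {A : E →L[ℝ] E}
    {C : Set E} (hC : IsClosed C) (hconv : Convex ℝ C) (hA : ∀ y ∈ C, A y ∈ C)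
    (hne : C.Nonempty) :
    (∃ z ∈ C, A z = z) ∨ ∃ r : ℝ, 1 ≤ r ∧ ∃ v, IsAsymptoticDirection C v ∧ A v = r • v := by
  let V := Submodule.span ℝ C
  have hCV : ∀ z ∈ C, z ∈ V := fun z hz => Submodule.subset_span hz
  have hAV : ∀ x ∈ V, A.toLinearMap x ∈ V := fun x hx =>
    (Submodule.span_le (p := V.comap A.toLinearMap)).2 (fun y hy => hCV _ (hA y hy)) hx
  let A' : V →L[ℝ] V := (A.toLinearMap.restrict hAV).toContinuousLinearMap
  have hA' : ∀ x : V, (A' x : E) = A x := fun x => rfl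
  have key := exists_fixedPoint_or_eigenvector_of_span_eq_top (A := A')
    (C := ((↑) : V → E) ⁻¹' C) (hC.preimage continuous_subtype_val)
    (hconv.linear_preimage V.subtype) (fun y hy => hA y hy)
    (let ⟨y, hy⟩ := hne; ⟨⟨y, hCV y hy⟩, hy⟩) Submodule.span_span_coe_preimage
  rcases key with ⟨z, hz, hz'⟩ | ⟨r, hr, v, ⟨hv0, hv⟩, hv'⟩
  · exact Or.inl ⟨z, hz, congrArg Subtype.val hz'⟩
  · refine Or.inr ⟨r, hr, v, ⟨by simpa using hv0, fun φ c hφ => ?_⟩, congrArg Subtype.val hv'⟩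
    exact hv (φ.comp V.subtypeL) c fun z hz => hφ _ hz
end
theorem volume_zeroSet_eq_zero {n m : ℕ} {g : Matrix (Fin n) (Fin n) ℝ × (Fin n → ℝ) ×
      Matrix (Fin m) (Fin n) ℝ × (Fin m → ℝ) → ℝ} (hg : Continuous g)
    (x₀ : Matrix (Fin n) (Fin n) ℝ × (Fin n → ℝ) × Matrix (Fin m) (Fin n) ℝ × (Fin m → ℝ))
    (h₀ : g x₀ ≠ 0) (hp : ∀ x, ∃ p : ℝ[X], ∀ t : ℝ, g (x₀ + t • x) = p.eval t) :
    volume {q | g q = 0} = 0 :=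
  have (a b : ℕ) : (volume : Measure (Fin a → Fin b → ℝ)).IsAddHaarMeasure :=
    Measure.pi.isAddHaarMeasure _
  have (a : ℕ) : (volume : Measure (Fin a → ℝ)).IsAddHaarMeasure := inferInstance
  have := Measure.prod.instIsAddHaarMeasure (volume : Measure (Fin m → Fin n → ℝ))
    (volume : Measure (Fin m → ℝ))
  have := Measure.prod.instIsAddHaarMeasure (volume : Measure (Fin n → ℝ))
    ((volume : Measure (Fin m → Fin n → ℝ)).prod (volume : Measure (Fin m → ℝ)))
  have := Measure.prod.instIsAddHaarMeasure (volume : Measure (Fin n → Fin n → ℝ))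
    ((volume : Measure (Fin n → ℝ)).prod
      ((volume : Measure (Fin m → Fin n → ℝ)).prod (volume : Measure (Fin m → ℝ))))
  measure_zeroSet_eq_zero_of_polynomial_on_lines
    (E := (Fin n → Fin n → ℝ) × (Fin n → ℝ) × (Fin m → Fin n → ℝ) × (Fin m → ℝ))
    (volume.prod (volume.prod (volume.prod volume))) hg x₀ h₀ hp

section
variable {n m : ℕ}

/-- The matrix of polynomials parametrizing the line through `M` in direction `N`. -/
noncomputable def lineMatrix {a b : ℕ} (M N : Matrix (Fin a) (Fin b) ℝ) :
    Matrix (Fin a) (Fin b) ℝ[X] :=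
  Matrix.of fun i j => C (M i j) + X * C (N i j)

theorem lineMatrix_map_eval {a b : ℕ} (M N : Matrix (Fin a) (Fin b) ℝ) (t : ℝ) :
    (lineMatrix M N).map (evalRingHom t) = M + t • N := by
  ext i j
  simp [lineMatrix, mul_comm t]

theorem volume_det_one_sub_eq_zero :
    volume {q : Matrix (Fin n) (Fin n) ℝ × (Fin n → ℝ) × Matrix (Fin m) (Fin n) ℝ × (Fin m → ℝ) |
      (1 - q.1).det = 0} = 0 := by
  refine volume_zeroSet_eq_zero (by fun_prop) 0 (by simp) fun x =>
    ⟨(1 - lineMatrix 0 x.1).det, fun t => ?_⟩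
  rw [← coe_evalRingHom, RingHom.map_det, map_sub, map_one, RingHom.mapMatrix_apply,
    lineMatrix_map_eval]
  rfl

theorem volume_fixedPoint_boundary_eq_zero (j : Fin m) :
    volume {q : Matrix (Fin n) (Fin n) ℝ × (Fin n → ℝ) × Matrix (Fin m) (Fin n) ℝ × (Fin m → ℝ) |
      q.2.2.1.mulVec ((1 - q.1).adjugate.mulVec q.2.1) j - (1 - q.1).det * q.2.2.2 j = 0} = 0 := by
  refine volume_zeroSet_eq_zero (by fun_prop) (0, 0, 0, 1) (by simp) fun x =>
    ⟨(lineMatrix 0 x.2.2.1).mulVec ((1 - lineMatrix 0 x.1).adjugate.mulVec fun i => X * C (x.2.1 i)) j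
      - (1 - lineMatrix 0 x.1).det * (1 + X * C (x.2.2.2 j)), fun t => ?_⟩
  rw [← coe_evalRingHom, map_sub, map_mul, RingHom.map_det, RingHom.map_mulVec,
    lineMatrix_map_eval]
  have h1 : (evalRingHom t) ∘ ((1 - lineMatrix 0 x.1).adjugate.mulVec fun i => X * C (x.2.1 i)) =
      (1 - (0 + t • x.1)).adjugate.mulVec (0 + t • x.2.1) := by
    ext i
    rw [Function.comp_apply, RingHom.map_mulVec, ← RingHom.mapMatrix_apply, RingHom.map_adjugate,
      map_sub, map_one, RingHom.mapMatrix_apply, lineMatrix_map_eval]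
    congr 1
    ext i
    simp [mul_comm t]
  rw [h1, map_sub, map_one, RingHom.mapMatrix_apply, lineMatrix_map_eval]
  simp [mul_comm t]

/-- The observability matrix of the `j`-th row of `B`. -/
def obsMatrix (A : Matrix (Fin n) (Fin n) ℝ) (B : Matrix (Fin m) (Fin n) ℝ) (j : Fin m) :
    Matrix (Fin n) (Fin n) ℝ :=
  Matrix.of fun i k => (B * A ^ (i : ℕ)) j k

/-- The Hankel matrix of power traces; its determinant is the discriminant of `A.charpoly`. -/
def traceMatrix (A : Matrix (Fin n) (Fin n) ℝ) : Matrix (Fin n) (Fin n) ℝ :=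
  Matrix.of fun i k => (A ^ (i + k : ℕ)).trace

theorem volume_det_obsMatrix_eq_zero (j : Fin m) :
    volume {q : Matrix (Fin n) (Fin n) ℝ × (Fin n → ℝ) × Matrix (Fin m) (Fin n) ℝ × (Fin m → ℝ) |
      (obsMatrix q.1 q.2.2.1 j).det = 0} = 0 := by
  refine volume_zeroSet_eq_zero (by unfold obsMatrix; fun_prop)
    (Matrix.diagonal fun i => (i : ℝ), 0, Matrix.of fun _ _ => 1, 0) ?_ fun x =>
    ⟨(Matrix.of fun i k : Fin n => (lineMatrix (Matrix.of fun _ _ => 1) x.2.2.1 *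
      lineMatrix (Matrix.diagonal fun i => (i : ℝ)) x.1 ^ (i : ℕ)) j k).det, fun t => ?_⟩
  · have : obsMatrix (Matrix.diagonal fun i : Fin n => (i : ℝ)) (Matrix.of fun _ _ => 1) j =
        (Matrix.vandermonde fun i : Fin n => (i : ℝ)).transpose := by
      ext i k
      simp [obsMatrix, Matrix.diagonal_pow, Matrix.vandermonde_apply]
    rw [this, Matrix.det_transpose, Matrix.det_vandermonde_ne_zero_iff]
    intro a b hab
    simpa [Fin.ext_iff] using hab
  · rw [← coe_evalRingHom, RingHom.map_det]
    congr 1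
    ext i k
    have h := congrFun (congrFun (Matrix.map_mul (L := lineMatrix (Matrix.of fun _ _ => 1) x.2.2.1)
      (M := lineMatrix (Matrix.diagonal fun i : Fin n => (i : ℝ)) x.1 ^ (i : ℕ))
      (f := evalRingHom t)) j) k
    rw [Matrix.map_pow, lineMatrix_map_eval, lineMatrix_map_eval] at h
    exact h.symm

theorem volume_det_traceMatrix_eq_zero :
    volume {q : Matrix (Fin n) (Fin n) ℝ × (Fin n → ℝ) × Matrix (Fin m) (Fin n) ℝ × (Fin m → ℝ) |
      (traceMatrix q.1).det = 0} = 0 := by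
  refine volume_zeroSet_eq_zero (by unfold traceMatrix; fun_prop)
    (Matrix.diagonal fun i => (i : ℝ), 0, 0, 0) ?_ fun x =>
    ⟨(Matrix.of fun i k : Fin n =>
      (lineMatrix (Matrix.diagonal fun i => (i : ℝ)) x.1 ^ (i + k : ℕ)).trace).det, fun t => ?_⟩
  · have : traceMatrix (Matrix.diagonal fun i : Fin n => (i : ℝ)) =
        (Matrix.vandermonde fun i : Fin n => (i : ℝ)).transpose *
          Matrix.vandermonde fun i : Fin n => (i : ℝ) := by
      ext i k
      simp [traceMatrix, Matrix.diagonal_pow, Matrix.vandermonde_apply, Matrix.mul_apply, pow_add]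
    rw [this, Matrix.det_mul, Matrix.det_transpose, mul_self_ne_zero,
      Matrix.det_vandermonde_ne_zero_iff]
    intro a b hab
    simpa [Fin.ext_iff] using hab
  · rw [← coe_evalRingHom, RingHom.map_det]
    congr 1
    ext i k
    rw [RingHom.mapMatrix_apply, Matrix.map_apply, Matrix.of_apply, AddMonoidHom.map_trace,
      Matrix.map_pow, lineMatrix_map_eval]
    rfl
end

section
variable {n m : ℕ}

theorem affine_iterate_add {A : Matrix (Fin n) (Fin n) ℝ} {b z : Fin n → ℝ}
    (hz : A.mulVec z + b = z) (y : Fin n → ℝ) (k : ℕ) :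
    (fun y => A.mulVec y + b)^[k] (z + y) = z + (A ^ k).mulVec y := by
  induction k with
  | zero => simp
  | succ k ih =>
    rw [Function.iterate_succ_apply', ih, pow_succ', ← Matrix.mulVec_mulVec, Matrix.mulVec_add]
    nth_rewrite 2 [← hz]
    abel

/-- The fixed point of `x ↦ A x + b`, given by the adjugate formula. -/
noncomputable def affineFixedPoint (A : Matrix (Fin n) (Fin n) ℝ) (b : Fin n → ℝ) : Fin n → ℝ :=
  (1 - A).det⁻¹ • (1 - A).adjugate.mulVec b

theorem mulVec_affineFixedPoint_add {A : Matrix (Fin n) (Fin n) ℝ} (hA : (1 - A).det ≠ 0)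
    (b : Fin n → ℝ) : A.mulVec (affineFixedPoint A b) + b = affineFixedPoint A b := by
  have h : (1 - A).mulVec (affineFixedPoint A b) = b := by
    rw [affineFixedPoint, Matrix.mulVec_smul, Matrix.mulVec_mulVec, Matrix.mul_adjugate,
      Matrix.smul_mulVec, Matrix.one_mulVec, smul_smul, inv_mul_cancel₀ hA, one_smul]
  rw [Matrix.sub_mulVec, Matrix.one_mulVec] at h
  nth_rewrite 2 [← h]
  abel

theorem eq_zero_of_mulVec_eq_self {A : Matrix (Fin n) (Fin n) ℝ} (hA : (1 - A).det ≠ 0)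
    {v : Fin n → ℝ} (hv : A.mulVec v = v) : v = 0 := by
  by_contra h0
  exact hA (Matrix.exists_mulVec_eq_zero_iff.1
    ⟨v, h0, by rw [Matrix.sub_mulVec, Matrix.one_mulVec, hv, sub_self]⟩)

theorem isTrappedAff_of_fixedPoint {A : Matrix (Fin n) (Fin n) ℝ} {b z : Fin n → ℝ}
    {B : Matrix (Fin m) (Fin n) ℝ} {η : Fin m → ℝ} (hz : A.mulVec z + b = z)
    (hB : ∀ j, η j < B.mulVec z j) : IsTrappedAff A b B η :=
  ⟨z, fun k j => by
    have := affine_iterate_add hz 0 k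
    rw [add_zero, Matrix.mulVec_zero, add_zero] at this
    rw [this]
    exact hB j⟩

theorem pow_mulVec_of_mulVec_eq_smul {A : Matrix (Fin n) (Fin n) ℝ} {r : ℝ} {v : Fin n → ℝ}
    (hv : A.mulVec v = r • v) (k : ℕ) : (A ^ k).mulVec v = r ^ k • v := by
  induction k with
  | zero => simp
  | succ k ih =>
    rw [pow_succ', ← Matrix.mulVec_mulVec, ih, Matrix.mulVec_smul, hv, smul_smul, pow_succ]

theorem isTrappedAff_of_eigenvector {A : Matrix (Fin n) (Fin n) ℝ} {b z v : Fin n → ℝ}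
    {B : Matrix (Fin m) (Fin n) ℝ} {η : Fin m → ℝ} (hz : A.mulVec z + b = z) {r : ℝ}
    (hr : 1 ≤ r) (hv : A.mulVec v = r • v) (hB : ∀ j, 0 < B.mulVec v j) :
    IsTrappedAff A b B η := by
  have hev : ∀ᶠ t : ℝ in atTop, ∀ j, η j - B.mulVec z j < t * B.mulVec v j :=
    eventually_all.2 fun j =>
      (tendsto_id.atTop_mul_const (hB j)).eventually_gt_atTop (η j - B.mulVec z j)
  obtain ⟨t, ht, ht0⟩ := (hev.and (eventually_ge_atTop 0)).exists
  refine ⟨z + t • v, fun k j => ?_⟩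
  rw [affine_iterate_add hz, Matrix.mulVec_smul, pow_mulVec_of_mulVec_eq_smul hv,
    Matrix.mulVec_add, Matrix.mulVec_smul, Matrix.mulVec_smul]
  simp only [Pi.add_apply, Pi.smul_apply, smul_eq_mul]
  have h1 : 1 ≤ r ^ k := one_le_pow₀ hr
  have h2 : 1 * B.mulVec v j ≤ r ^ k * B.mulVec v j :=
    mul_le_mul_of_nonneg_right h1 (hB j).le
  nlinarith [ht j, mul_le_mul_of_nonneg_left h2 ht0]

theorem IsTrappedAff.fixedPoint_or_eigenvector {A : Matrix (Fin n) (Fin n) ℝ} {b : Fin n → ℝ}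
    {B : Matrix (Fin m) (Fin n) ℝ} {η : Fin m → ℝ} (hA : (1 - A).det ≠ 0)
    (h : IsTrappedAff A b B η) :
    (∀ j, η j ≤ B.mulVec (affineFixedPoint A b) j) ∨
      ∃ r : ℝ, 1 ≤ r ∧ ∃ v, v ≠ 0 ∧ A.mulVec v = r • v ∧ ∀ j, 0 ≤ B.mulVec v j := by
  obtain ⟨x, hx⟩ := h
  set z := affineFixedPoint A b with hzdef
  have hz : A.mulVec z + b = z := mulVec_affineFixedPoint_add hA b
  let L : (Fin n → ℝ) →L[ℝ] (Fin n → ℝ) := (Matrix.mulVecLin A).toContinuousLinearMap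
  have hL : ∀ y, L y = A.mulVec y := fun y => rfl
  let φ : ℕ → Fin m → (Fin n → ℝ) →L[ℝ] ℝ := fun k j =>
    (LinearMap.proj j ∘ₗ Matrix.mulVecLin (B * A ^ k)).toContinuousLinearMap
  have hφ : ∀ k j y, φ k j y = (B * A ^ k).mulVec y j := fun k j y => rfl
  let S : Set (Fin n → ℝ) := ⋂ k, ⋂ j, {y | η j - B.mulVec z j ≤ φ k j y}
  have hS : ∀ y, y ∈ S ↔ ∀ k j, η j - B.mulVec z j ≤ φ k j y := fun y => by
    simp only [S, Set.mem_iInter]; rfl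
  have key := exists_fixedPoint_or_eigenvector (A := L) (C := S)
    (isClosed_iInter fun k => isClosed_iInter fun j =>
      isClosed_le continuous_const (φ k j).continuous)
    (convex_iInter fun k => convex_iInter fun j =>
      convex_halfSpace_ge (φ k j).toLinearMap.isLinear _)
    (fun y hy => (hS _).2 fun k j => by
      have := (hS y).1 hy (k + 1) j
      rwa [hφ, pow_succ, ← Matrix.mul_assoc, ← Matrix.mulVec_mulVec] at this)
    ⟨x - z, (hS _).2 fun k j => by
      have h1 := hx k j
      rw [← add_sub_cancel z x, affine_iterate_add hz, Matrix.mulVec_add,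
        Matrix.mulVec_mulVec, Pi.add_apply] at h1
      rw [hφ]
      linarith⟩
  rcases key with ⟨w, hw, hw'⟩ | ⟨r, hr, v, ⟨hv0, hv⟩, hv'⟩
  · left
    intro j
    have h1 := (hS w).1 hw 0 j
    rw [eq_zero_of_mulVec_eq_self hA hw', map_zero] at h1
    linarith
  · refine Or.inr ⟨r, hr, v, hv0, hv', fun j => ?_⟩
    have := hv (φ 0 j) _ fun y hy => (hS y).1 hy 0 j
    rwa [hφ, pow_zero, Matrix.mul_one] at this

theorem mulVec_ne_zero_of_eigenvector {A : Matrix (Fin n) (Fin n) ℝ}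
    {B : Matrix (Fin m) (Fin n) ℝ} {j : Fin m} (hobs : (obsMatrix A B j).det ≠ 0) {r : ℝ}
    {v : Fin n → ℝ} (hv0 : v ≠ 0) (hv : A.mulVec v = r • v) : B.mulVec v j ≠ 0 := by
  intro h0
  refine hobs (Matrix.exists_mulVec_eq_zero_iff.1 ⟨v, hv0, ?_⟩)
  ext i
  change (B * A ^ (i : ℕ)).mulVec v j = 0
  rw [← Matrix.mulVec_mulVec, pow_mulVec_of_mulVec_eq_smul hv, Matrix.mulVec_smul,
    Pi.smul_apply, h0, smul_zero]

theorem eval_ne_zero_of_det_traceMatrix_ne_zero {A : Matrix (Fin n) (Fin n) ℝ}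
    (hA : (traceMatrix A).det ≠ 0) {r : ℝ} {s : ℝ[X]} (hs : A.charpoly = (X - C r) * s) :
    s.eval r ≠ 0 := by
  intro h0
  obtain ⟨u, hu⟩ := dvd_iff_isRoot.2 h0
  have hmonic := A.charpoly_monic
  have hs0 : s ≠ 0 := by
    rintro rfl
    exact hmonic.ne_zero (by simpa using hs)
  have hdeg : s.natDegree + 1 = n := by
    have := congrArg natDegree hs
    rw [Matrix.charpoly_natDegree_eq_dim, natDegree_mul (X_sub_C_ne_zero r) hs0,
      natDegree_X_sub_C, Fintype.card_fin] at this
    omega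
  have hnil : IsNilpotent (aeval A s) := by
    refine ⟨2, ?_⟩
    have : s ^ 2 = A.charpoly * u := by
      rw [sq, hs]
      nth_rewrite 2 [hu]
      ring
    rw [← map_pow, this, map_mul, Matrix.aeval_self_charpoly, zero_mul]
  refine hA (Matrix.exists_mulVec_eq_zero_iff.1 ⟨fun i : Fin n => s.coeff i, ?_, ?_⟩)
  · intro h
    apply hs0
    rw [← leadingCoeff_eq_zero]
    exact congrFun h ⟨s.natDegree, by omega⟩
  · ext i
    have h1 : IsNilpotent (A ^ (i : ℕ) * aeval A s) :=
      Commute.isNilpotent_mul_left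
        (by simpa using (Commute.all (X ^ (i : ℕ)) s).map (aeval A)) hnil
    have h2 := (Matrix.isNilpotent_trace_of_isNilpotent h1).eq_zero
    rw [aeval_eq_sum_range, hdeg, Finset.mul_sum, Matrix.trace_sum, Finset.sum_range] at h2
    simp only [mul_smul_comm, Matrix.trace_smul, ← pow_add, smul_eq_mul] at h2
    simp only [Matrix.mulVec, dotProduct, traceMatrix, Matrix.of_apply, Pi.zero_apply]
    rw [← h2]
    exact Finset.sum_congr rfl fun k _ => mul_comm _ _

theorem adjugate_ne_zero_of_simple_root {A : Matrix (Fin n) (Fin n) ℝ} {r : ℝ} {s : ℝ[X]}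
    (hs : A.charpoly = (X - C r) * s) (hr : s.eval r ≠ 0) :
    (Matrix.scalar (Fin n) r - A).adjugate ≠ 0 := by
  intro h0
  have hmap : (evalRingHom r).mapMatrix A.charmatrix = Matrix.scalar (Fin n) r - A := by
    ext i k
    by_cases h : i = k
    · subst h; simp
    · simp [h]
  have hdvd : ∀ i k, (X - C r) ∣ A.charmatrix.adjugate i k := fun i k => by
    rw [dvd_iff_isRoot]
    have := congrFun (congrFun h0 i) k
    rwa [← hmap, ← RingHom.map_adjugate] at this
  choose G hG using hdvd
  have hG' : A.charmatrix.adjugate = (X - C r) • Matrix.of G := by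
    ext1 i k
    exact hG i k
  have h1 := A.charmatrix.mul_adjugate
  change _ = A.charpoly • (1 : Matrix (Fin n) (Fin n) ℝ[X]) at h1
  rw [hG', hs, Matrix.mul_smul, mul_smul] at h1
  have h2 : A.charmatrix * Matrix.of G = s • (1 : Matrix (Fin n) (Fin n) ℝ[X]) :=
    smul_right_injective _ (X_sub_C_ne_zero r) h1
  have h3 := congrArg (fun M => (evalRingHom r).mapMatrix M) h2
  simp only [map_mul, hmap] at h3
  have h4 : (evalRingHom r).mapMatrix (s • (1 : Matrix (Fin n) (Fin n) ℝ[X])) =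
      s.eval r • (1 : Matrix (Fin n) (Fin n) ℝ) := by
    ext i k
    by_cases h : i = k
    · subst h; simp
    · simp [h]
  rw [h4] at h3
  have h5 := congrArg Matrix.det h3
  rw [Matrix.det_mul, Matrix.det_smul, Matrix.det_one, ← Matrix.eval_charpoly, hs] at h5
  have : s.eval r ^ Fintype.card (Fin n) ≠ 0 := pow_ne_zero _ hr
  apply this
  simpa using h5.symm

theorem mulVec_adjugate_col {A : Matrix (Fin n) (Fin n) ℝ} {r : ℝ} (hr : A.charpoly.eval r = 0)
    (u : Fin n → ℝ) :
    A.mulVec ((Matrix.scalar (Fin n) r - A).adjugate.mulVec u) =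
      r • (Matrix.scalar (Fin n) r - A).adjugate.mulVec u := by
  have h : (Matrix.scalar (Fin n) r - A).mulVec
      ((Matrix.scalar (Fin n) r - A).adjugate.mulVec u) = 0 := by
    rw [Matrix.mulVec_mulVec, Matrix.mul_adjugate, ← Matrix.eval_charpoly, hr, zero_smul,
      Matrix.zero_mulVec]
  rw [Matrix.sub_mulVec, sub_eq_zero] at h
  rw [← h]
  simp [Matrix.scalar_apply, ← Matrix.smul_one_eq_diagonal, Matrix.smul_mulVec]
end

section
variable {n m : ℕ}

theorem exists_root_of_mul_neg {F : ℝ → ℝ} (hF : Continuous F) {a b : ℝ} (hab : a ≤ b)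
    (h : F a * F b < 0) : ∃ x ∈ Icc a b, F x = 0 := by
  rcases mul_neg_iff.1 h with ⟨ha, hb⟩ | ⟨ha, hb⟩
  · exact intermediate_value_Icc' hab hF.continuousOn ⟨hb.le, ha.le⟩
  · exact intermediate_value_Icc hab hF.continuousOn ⟨ha.le, hb.le⟩

theorem eventually_isTrappedAff_of_fixedPoint
    {q₀ : Matrix (Fin n) (Fin n) ℝ × (Fin n → ℝ) × Matrix (Fin m) (Fin n) ℝ × (Fin m → ℝ)}
    (hdet : ∀ᶠ q in 𝓝 q₀, (1 - q.1).det ≠ 0)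
    (hB : ∀ᶠ q in 𝓝 q₀, ∀ j, q.2.2.2 j < q.2.2.1.mulVec (affineFixedPoint q.1 q.2.1) j) :
    ∀ᶠ q in 𝓝 q₀, IsTrappedAff q.1 q.2.1 q.2.2.1 q.2.2.2 := by
  filter_upwards [hdet, hB] with q hq hq'
  exact isTrappedAff_of_fixedPoint (mulVec_affineFixedPoint_add hq _) hq'

theorem eventually_isTrappedAff_of_eigenvector
    {q₀ : Matrix (Fin n) (Fin n) ℝ × (Fin n → ℝ) × Matrix (Fin m) (Fin n) ℝ × (Fin m → ℝ)}
    (hdet : ∀ᶠ q in 𝓝 q₀, (1 - q.1).det ≠ 0)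
    (hobs : ∀ j, (obsMatrix q₀.1 q₀.2.2.1 j).det ≠ 0) (htr : (traceMatrix q₀.1).det ≠ 0)
    {r : ℝ} (hr : 1 < r) {v : Fin n → ℝ} (hv0 : v ≠ 0) (hv : q₀.1.mulVec v = r • v)
    (hB : ∀ j, 0 < q₀.2.2.1.mulVec v j) :
    ∀ᶠ q in 𝓝 q₀, IsTrappedAff q.1 q.2.1 q.2.2.1 q.2.2.2 := by
  have hroot : q₀.1.charpoly.eval r = 0 := by
    rw [Matrix.eval_charpoly]
    refine Matrix.exists_mulVec_eq_zero_iff.1 ⟨v, hv0, ?_⟩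
    rw [Matrix.sub_mulVec, hv, sub_eq_zero]
    simp [Matrix.scalar_apply, ← Matrix.smul_one_eq_diagonal, Matrix.smul_mulVec]
  obtain ⟨s, hs⟩ := dvd_iff_isRoot.2 hroot
  have hsr := eval_ne_zero_of_det_traceMatrix_ne_zero htr hs
  obtain ⟨u, hu⟩ : ∃ u, (Matrix.scalar (Fin n) r - q₀.1).adjugate.mulVec u ≠ 0 := by
    by_contra! h
    exact adjugate_ne_zero_of_simple_root hs hsr
      (Matrix.mulVec_injective (by ext1 u; rw [h u, Matrix.zero_mulVec]))
  obtain ⟨α, hα⟩ : ∃ α : ℝ, ∀ j,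
      0 < q₀.2.2.1.mulVec (α • (Matrix.scalar (Fin n) r - q₀.1).adjugate.mulVec u) j := by
    rcases isEmpty_or_nonempty (Fin m) with _ | ⟨⟨j⟩⟩
    · exact ⟨0, isEmptyElim⟩
    set w := (Matrix.scalar (Fin n) r - q₀.1).adjugate.mulVec u with hw
    have hw' : q₀.1.mulVec w = r • w := mulVec_adjugate_col hroot u
    have hwj := mulVec_ne_zero_of_eigenvector (hobs j) hu hw'
    refine ⟨q₀.2.2.1.mulVec v j / q₀.2.2.1.mulVec w j, ?_⟩
    suffices h : v = (q₀.2.2.1.mulVec v j / q₀.2.2.1.mulVec w j) • w by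
      rw [← h]
      exact hB
    by_contra h
    refine mulVec_ne_zero_of_eigenvector (hobs j) (sub_ne_zero.2 h) (r := r) ?_ ?_
    · rw [Matrix.mulVec_sub, Matrix.mulVec_smul, hv, hw', smul_sub, smul_comm]
    · rw [Matrix.mulVec_sub, Matrix.mulVec_smul, Pi.sub_apply, Pi.smul_apply, smul_eq_mul,
        div_mul_cancel₀ _ hwj, sub_self]
  have hpos : ∀ᶠ p in 𝓝 q₀ ×ˢ 𝓝 r, ∀ j,
      0 < p.1.2.2.1.mulVec (α • (Matrix.scalar (Fin n) p.2 - p.1.1).adjugate.mulVec u) j := by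
    rw [← nhds_prod_eq]
    refine eventually_all.2 fun j => ?_
    have hc : Continuous fun p : (Matrix (Fin n) (Fin n) ℝ × (Fin n → ℝ) ×
        Matrix (Fin m) (Fin n) ℝ × (Fin m → ℝ)) × ℝ =>
        p.1.2.2.1.mulVec (α • (Matrix.scalar (Fin n) p.2 - p.1.1).adjugate.mulVec u) j := by
      simp only [Matrix.scalar_apply]
      fun_prop
    exact hc.continuousAt.eventually (lt_mem_nhds (hα j))
  obtain ⟨P, hP, R, hR, hPR⟩ := eventually_prod_iff.1 hpos
  have hsign : ∀ᶠ x in 𝓝 r, 0 < s.eval x * s.eval r :=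
    (s.continuous.mul continuous_const).continuousAt.eventually
      (lt_mem_nhds (mul_self_pos.2 hsr))
  obtain ⟨δ, hδ, hδ'⟩ := Metric.eventually_nhds_iff.1 ((hR.and hsign).and (lt_mem_nhds hr))
  have hball : ∀ x ∈ Icc (r - δ / 2) (r + δ / 2), (R x ∧ 0 < s.eval x * s.eval r) ∧ 1 < x :=
    fun x hx => hδ' (by rw [Real.dist_eq, abs_lt]; constructor <;> linarith [hx.1, hx.2])
  have hneg : (Matrix.scalar (Fin n) (r - δ / 2) - q₀.1).det *
      (Matrix.scalar (Fin n) (r + δ / 2) - q₀.1).det < 0 := by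
    rw [← Matrix.eval_charpoly, ← Matrix.eval_charpoly, hs]
    simp only [eval_mul, eval_sub, eval_X, eval_C]
    have h1 := (hball (r - δ / 2) ⟨le_rfl, by linarith⟩).1.2
    have h2 := (hball (r + δ / 2) ⟨by linarith, le_rfl⟩).1.2
    have h3 : 0 < eval (r - δ / 2) s * eval (r + δ / 2) s := by
      have h4 := mul_pos h1 h2
      have h5 : eval (r - δ / 2) s * eval (r + δ / 2) s * (eval r s * eval r s) > 0 := by
        linarith
      exact pos_of_mul_pos_left h5 (mul_self_nonneg _)
    nlinarith [mul_pos (mul_pos hδ hδ) h3]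
  have hcneg : Continuous fun q : Matrix (Fin n) (Fin n) ℝ × (Fin n → ℝ) ×
      Matrix (Fin m) (Fin n) ℝ × (Fin m → ℝ) =>
      (Matrix.scalar (Fin n) (r - δ / 2) - q.1).det *
        (Matrix.scalar (Fin n) (r + δ / 2) - q.1).det := by fun_prop
  filter_upwards [hdet, hP, hcneg.continuousAt.eventually (gt_mem_nhds hneg)] with q hq hqP hqneg
  rw [← Matrix.eval_charpoly, ← Matrix.eval_charpoly] at hqneg
  obtain ⟨x, hx, hx0⟩ := exists_root_of_mul_neg q.1.charpoly.continuous (by linarith) hqneg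
  refine isTrappedAff_of_eigenvector (mulVec_affineFixedPoint_add hq _) (hball x hx).2.le
    (v := α • (Matrix.scalar (Fin n) x - q.1).adjugate.mulVec u) ?_ (hPR hqP (hball x hx).1.1)
  rw [Matrix.mulVec_smul, mulVec_adjugate_col hx0, smul_comm]

/-- Instances with a normalized eigenvector of inverse eigenvalue in `[0, 1]` lying in the
recession cone of the polyhedron. -/
def eigenvectorInstances (n m : ℕ) : Set (Matrix (Fin n) (Fin n) ℝ × (Fin n → ℝ) ×
    Matrix (Fin m) (Fin n) ℝ × (Fin m → ℝ)) :=
  {q | ∃ μ ∈ Icc (0 : ℝ) 1, ∃ v ∈ Metric.sphere (0 : Fin n → ℝ) 1,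
    μ • q.1.mulVec v = v ∧ ∀ j, 0 ≤ q.2.2.1.mulVec v j}

theorem isClosed_eigenvectorInstances : IsClosed (eigenvectorInstances n m) := by
  have : CompactSpace (Metric.sphere (0 : Fin n → ℝ) 1) :=
    isCompact_iff_compactSpace.1 (isCompact_sphere _ _)
  have hcl : IsClosed {p : (Matrix (Fin n) (Fin n) ℝ × (Fin n → ℝ) ×
      Matrix (Fin m) (Fin n) ℝ × (Fin m → ℝ)) ×
        (Icc (0 : ℝ) 1 × Metric.sphere (0 : Fin n → ℝ) 1) |
      (p.2.1 : ℝ) • p.1.1.mulVec (p.2.2 : Fin n → ℝ) = p.2.2 ∧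
        ∀ j, 0 ≤ p.1.2.2.1.mulVec (p.2.2 : Fin n → ℝ) j} := by
    rw [ofPred_and, ofPred_forall]
    exact (isClosed_eq (by fun_prop) (by fun_prop)).inter
      (isClosed_iInter fun j => isClosed_le (by fun_prop) (by fun_prop))
  convert isClosedMap_fst_of_compactSpace _ hcl using 1
  ext q
  constructor
  · rintro ⟨μ, hμ, v, hv, h⟩
    exact ⟨(q, ⟨μ, hμ⟩, ⟨v, hv⟩), h, rfl⟩
  · rintro ⟨⟨q', μ, v⟩, h, rfl⟩
    exact ⟨μ, μ.2, v, v.2, h⟩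

theorem mem_eigenvectorInstances
    {q : Matrix (Fin n) (Fin n) ℝ × (Fin n → ℝ) × Matrix (Fin m) (Fin n) ℝ × (Fin m → ℝ)}
    {r : ℝ} (hr : 1 ≤ r) {v : Fin n → ℝ} (hv0 : v ≠ 0) (hv : q.1.mulVec v = r • v)
    (hB : ∀ j, 0 ≤ q.2.2.1.mulVec v j) : q ∈ eigenvectorInstances n m := by
  have hr0 : 0 < r := by linarith
  refine ⟨r⁻¹, ⟨by positivity, inv_le_one_of_one_le₀ hr⟩, ‖v‖⁻¹ • v, ?_, ?_, fun j => ?_⟩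
  · rw [mem_sphere_zero_iff_norm, norm_smul, norm_inv, norm_norm,
      inv_mul_cancel₀ (norm_ne_zero_iff.2 hv0)]
  · rw [Matrix.mulVec_smul, hv, smul_comm ‖v‖⁻¹, smul_smul, inv_mul_cancel₀ hr0.ne', one_smul]
  · rw [Matrix.mulVec_smul]
    exact mul_nonneg (by positivity) (hB j)

theorem exists_eigenvector_of_mem_eigenvectorInstances
    {q : Matrix (Fin n) (Fin n) ℝ × (Fin n → ℝ) × Matrix (Fin m) (Fin n) ℝ × (Fin m → ℝ)}
    (hdet : (1 - q.1).det ≠ 0) (hobs : ∀ j, (obsMatrix q.1 q.2.2.1 j).det ≠ 0)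
    (hq : q ∈ eigenvectorInstances n m) :
    ∃ r : ℝ, 1 < r ∧ ∃ v, v ≠ 0 ∧ q.1.mulVec v = r • v ∧ ∀ j, 0 < q.2.2.1.mulVec v j := by
  obtain ⟨μ, ⟨hμ0, hμ1⟩, v, hv, hμv, hB⟩ := hq
  have hv0 : v ≠ 0 := ne_zero_of_mem_unit_sphere ⟨v, hv⟩
  have hμ : 0 < μ := hμ0.lt_of_ne (by
    rintro rfl
    exact hv0 (by rw [← hμv, zero_smul]))
  have hAv : q.1.mulVec v = μ⁻¹ • v := by
    nth_rewrite 2 [← hμv]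
    rw [smul_smul, inv_mul_cancel₀ hμ.ne', one_smul]
  have hμ1' : μ < 1 := hμ1.lt_of_ne (by
    rintro rfl
    exact hv0 (eq_zero_of_mulVec_eq_self hdet (by simpa using hμv)))
  exact ⟨μ⁻¹, (one_lt_inv₀ hμ).2 hμ1', v, hv0, hAv, fun j =>
    (hB j).lt_of_ne (mulVec_ne_zero_of_eigenvector (hobs j) hv0 hAv).symm⟩

theorem eventually_isTrappedAff_of_frequently
    {q₀ : Matrix (Fin n) (Fin n) ℝ × (Fin n → ℝ) × Matrix (Fin m) (Fin n) ℝ × (Fin m → ℝ)}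
    (hdet₀ : (1 - q₀.1).det ≠ 0) (hobs : ∀ j, (obsMatrix q₀.1 q₀.2.2.1 j).det ≠ 0)
    (htr : (traceMatrix q₀.1).det ≠ 0)
    (hfix : ∀ j, q₀.2.2.1.mulVec ((1 - q₀.1).adjugate.mulVec q₀.2.1) j -
      (1 - q₀.1).det * q₀.2.2.2 j ≠ 0)
    (hfreq : ∃ᶠ q in 𝓝 q₀, IsTrappedAff q.1 q.2.1 q.2.2.1 q.2.2.2) :
    ∀ᶠ q in 𝓝 q₀, IsTrappedAff q.1 q.2.1 q.2.2.1 q.2.2.2 := by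
  have hcdet : Continuous fun q : Matrix (Fin n) (Fin n) ℝ × (Fin n → ℝ) ×
      Matrix (Fin m) (Fin n) ℝ × (Fin m → ℝ) => (1 - q.1).det := by fun_prop
  have hdet : ∀ᶠ q in 𝓝 q₀, (1 - q.1).det ≠ 0 := hcdet.continuousAt.eventually_ne hdet₀
  have hcfix : ∀ j, ContinuousAt (fun q : Matrix (Fin n) (Fin n) ℝ × (Fin n → ℝ) ×
      Matrix (Fin m) (Fin n) ℝ × (Fin m → ℝ) =>
      q.2.2.1.mulVec (affineFixedPoint q.1 q.2.1) j) q₀ := fun j => by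
    simp only [affineFixedPoint, Matrix.mulVec_smul, Pi.smul_apply]
    exact (hcdet.continuousAt.inv₀ hdet₀).smul (by fun_prop)
  have hcη : ∀ j, ContinuousAt (fun q : Matrix (Fin n) (Fin n) ℝ × (Fin n → ℝ) ×
      Matrix (Fin m) (Fin n) ℝ × (Fin m → ℝ) => q.2.2.2 j) q₀ := fun j => by fun_prop
  have hor := (hfreq.and_eventually hdet).mono fun q hq => hq.1.fixedPoint_or_eigenvector hq.2
  rcases frequently_or_distrib.1 hor with h | h
  · refine eventually_isTrappedAff_of_fixedPoint hdet (eventually_all.2 fun j => ?_)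
    refine (hcη j).eventually_lt (hcfix j) (lt_of_le_of_ne ?_ fun heq => hfix j ?_)
    · by_contra! hlt
      obtain ⟨q, hq, hq'⟩ := (h.and_eventually ((hcfix j).eventually_lt (hcη j) hlt)).exists
      exact absurd (hq j) (not_le.2 hq')
    · rw [heq, affineFixedPoint, Matrix.mulVec_smul, Pi.smul_apply, smul_eq_mul,
        mul_inv_cancel_left₀ hdet₀, sub_self]
  · have hmem : q₀ ∈ eigenvectorInstances n m :=
      isClosed_eigenvectorInstances.mem_of_frequently_of_tendsto
        (h.mono fun q ⟨r, hr, v, hv0, hv, hB⟩ => mem_eigenvectorInstances hr hv0 hv hB) tendsto_id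
    obtain ⟨r, hr, v, hv0, hv, hB⟩ :=
      exists_eigenvector_of_mem_eigenvectorInstances hdet₀ hobs hmem
    exact eventually_isTrappedAff_of_eigenvector hdet hobs htr hr hv0 hv hB
end

/-- The set of boundary instances of the Affine Universal Escape Problem has Lebesgue
measure zero. -/
theorem boundary_affine_escape_measure_zero (n m : ℕ) :
    volume (frontier {q : Matrix (Fin n) (Fin n) ℝ × (Fin n → ℝ) ×
      Matrix (Fin m) (Fin n) ℝ × (Fin m → ℝ) |
        ¬ IsTrappedAff q.1 q.2.1 q.2.2.1 q.2.2.2}) = 0 := by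
  have hdet := measure_eq_zero_iff_ae_notMem.1 (volume_det_one_sub_eq_zero (n := n) (m := m))
  have htr := measure_eq_zero_iff_ae_notMem.1 (volume_det_traceMatrix_eq_zero (n := n) (m := m))
  have hobs := ae_all_iff.2 fun j : Fin m =>
    measure_eq_zero_iff_ae_notMem.1 (volume_det_obsMatrix_eq_zero (n := n) j)
  have hfix := ae_all_iff.2 fun j : Fin m =>
    measure_eq_zero_iff_ae_notMem.1 (volume_fixedPoint_boundary_eq_zero (n := n) j)
  rw [measure_eq_zero_iff_ae_notMem]
  filter_upwards [hdet, htr, hobs, hfix] with q hq₁ hq₂ hq₃ hq₄ hq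
  change q ∈ frontier {q : Matrix (Fin n) (Fin n) ℝ × (Fin n → ℝ) ×
    Matrix (Fin m) (Fin n) ℝ × (Fin m → ℝ) | IsTrappedAff q.1 q.2.1 q.2.2.1 q.2.2.2}ᶜ at hq
  rw [frontier_compl] at hq
  exact hq.2 (mem_interior_iff_mem_nhds.2 (eventually_isTrappedAff_of_frequently hq₁ hq₃ hq₂ hq₄
    (mem_closure_iff_frequently.1 hq.1)))
end

section
/- Let A ∈ ℝ^{n×n}, b ∈ ℝⁿ, B ∈ ℝ^{m×n}, η ∈ ℝ^m, and f(x) = A x + b. Define Â ∈ ℝ^{(n+1)×(n+1)} with block form (A, b; 0, 1) and B̂ ∈ ℝ^{(m+1)×(n+1)} with block form (B, −η; 0, 1). Suppose that for every real eigenvalue λ ≥ 1 of Â and every v̂ ∈ ℝ^{n+1} with ‖v̂‖ = 1 and Â v̂ = λ v̂, there exists j ∈ {1,...,m+1} with B̂_j v̂ < 0. Then the affine instance (A, b, B, η) is escaping: for every x ∈ ℝⁿ there exists k ≥ 0 and j ∈ {1,...,m} with B_j (f^k(x)) ≤ η_j. -/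
/-- The homogenisation `Â = (A, b; 0, 1)` of the affine map `x ↦ A x + b`. -/
def hatA {n : ℕ} (A : Matrix (Fin n) (Fin n) ℝ) (b : Fin n → ℝ) :
    Matrix (Fin (n + 1)) (Fin (n + 1)) ℝ :=
  Matrix.of fun i j =>
    if hi : (i : ℕ) < n then
      if hj : (j : ℕ) < n then A ⟨i, hi⟩ ⟨j, hj⟩ else b ⟨i, hi⟩
    else
      if (j : ℕ) < n then 0 else 1

/-- The homogenisation `B̂ = (B, -η; 0, 1)` of the affine constraints `B x ⊳ η`. -/
def hatB {m n : ℕ} (B : Matrix (Fin m) (Fin n) ℝ) (η : Fin m → ℝ) :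
    Matrix (Fin (m + 1)) (Fin (n + 1)) ℝ :=
  Matrix.of fun i j =>
    if hi : (i : ℕ) < m then
      if hj : (j : ℕ) < n then B ⟨i, hi⟩ ⟨j, hj⟩ else -η ⟨i, hi⟩
    else
      if (j : ℕ) < n then 0 else 1

section ConeEigenvector

variable {E : Type*} [NormedAddCommGroup E] [NormedSpace ℝ E]

lemma PointedCone.mem_of_hasSum {K : PointedCone ℝ E} (hK : IsClosed (K : Set E))
    {s : ℕ → E} {u : E} (hs : ∀ k, s k ∈ K) (hu : HasSum s u) : u ∈ K :=
  hK.mem_of_tendsto hu (Filter.Eventually.of_forall fun _ => K.sum_mem fun k _ => hs k)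

/-- Solvability of `lam • u - A u = y` within a closed cone persists when `lam` decreases by less
than a lower bound of `lam - A` on the cone. -/
lemma PointedCone.exists_resolvent_sub [CompleteSpace E] {K : PointedCone ℝ E}
    (hK : IsClosed (K : Set E)) (A : E →L[ℝ] E) {lam c δ : ℝ} (hδ : 0 ≤ δ) (hδc : δ < c)
    (hc : ∀ u ∈ K, c * ‖u‖ ≤ ‖lam • u - A u‖)
    (hsol : ∀ y ∈ K, ∃ u ∈ K, lam • u - A u = y) :
    ∀ y ∈ K, ∃ u ∈ K, (lam - δ) • u - A u = y := by
  intro y hy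
  choose! g hgK hg using hsol
  have hc0 : 0 < c := hδ.trans_lt hδc
  have hmem : ∀ k, g^[k] y ∈ K := fun k => by
    induction k with
    | zero => exact hy
    | succ k ih => rw [Function.iterate_succ_apply']; exact hgK _ ih
  have hstep : ∀ k, lam • g^[k + 1] y - A (g^[k + 1] y) = g^[k] y := fun k => by
    rw [Function.iterate_succ_apply']; exact hg _ (hmem k)
  have hbound : ∀ k, ‖g^[k] y‖ ≤ (c⁻¹) ^ k * ‖y‖ := fun k => by
    induction k with
    | zero => simp
    | succ k ih =>
      have h1 := hc _ (hmem (k + 1))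
      rw [hstep] at h1
      calc ‖g^[k + 1] y‖ ≤ c⁻¹ * ‖g^[k] y‖ := by
            rw [inv_mul_eq_div, le_div_iff₀ hc0]; linarith
        _ ≤ c⁻¹ * ((c⁻¹) ^ k * ‖y‖) := by gcongr
        _ = _ := by ring
  have hsum : Summable fun k => δ ^ k • g^[k] y := by
    refine Summable.of_norm_bounded
      ((summable_geometric_of_lt_one (r := δ / c) (by positivity)
        ((div_lt_one hc0).2 hδc)).mul_right ‖y‖) fun k => ?_
    rw [norm_smul, norm_pow, Real.norm_of_nonneg hδ]
    calc δ ^ k * ‖g^[k] y‖ ≤ δ ^ k * ((c⁻¹) ^ k * ‖y‖) := by gcongr; exact hbound k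
      _ = (δ / c) ^ k * ‖y‖ := by rw [div_eq_mul_inv, mul_pow]; ring
  have hsum' : Summable fun k => δ ^ k • g^[k + 1] y := by
    refine Summable.of_norm_bounded
      ((summable_geometric_of_lt_one (r := δ / c) (by positivity)
        ((div_lt_one hc0).2 hδc)).mul_right (c⁻¹ * ‖y‖)) fun k => ?_
    rw [norm_smul, norm_pow, Real.norm_of_nonneg hδ]
    calc δ ^ k * ‖g^[k + 1] y‖ ≤ δ ^ k * ((c⁻¹) ^ (k + 1) * ‖y‖) := by gcongr; exact hbound _
      _ = (δ / c) ^ k * (c⁻¹ * ‖y‖) := by rw [div_eq_mul_inv, mul_pow]; ring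
  obtain ⟨u, hu⟩ := hsum'
  refine ⟨u, mem_of_hasSum hK (fun k => K.smul_mem (pow_nonneg hδ k) (hmem _)) hu, ?_⟩
  have h1 : HasSum (fun k => δ ^ k • g^[k] y) (lam • u - A u) := by
    convert (hu.const_smul lam).sub (A.hasSum hu) using 2 with k
    rw [← hstep k, map_smul, smul_sub, smul_comm]
  have h2 : HasSum (fun k => δ ^ (k + 1) • g^[k + 1] y) (δ • u) := by
    convert hu.const_smul δ using 2 with k
    rw [smul_smul, pow_succ']
  have h3 := (hasSum_nat_add_iff' 1).2 h1
  have h4 := h3.unique h2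
  simp only [Finset.sum_range_one, pow_zero, one_smul, Function.iterate_zero, id_eq] at h4
  rw [sub_smul, sub_right_comm, ← h4, sub_sub_cancel]

/-- For `lam` above the operator norm, `lam • u - A u = y` is solvable within every closed cone
that is invariant under `A`. -/
lemma PointedCone.exists_resolvent_of_norm_lt [CompleteSpace E] {K : PointedCone ℝ E}
    (hK : IsClosed (K : Set E)) (A : E →L[ℝ] E) (hA : ∀ u ∈ K, A u ∈ K) {lam : ℝ}
    (hlam : ‖A‖ < lam) : ∀ y ∈ K, ∃ u ∈ K, lam • u - A u = y := by
  intro y hy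
  have h0 : 0 < lam := (norm_nonneg A).trans_lt hlam
  have hsum : Summable fun k : ℕ => (lam⁻¹ • A) ^ k := by
    refine summable_geometric_of_norm_lt_one ?_
    rw [norm_smul, norm_inv, Real.norm_of_nonneg h0.le, inv_mul_eq_div]
    exact (div_lt_one h0).2 hlam
  have hmem : ∀ k : ℕ, ((lam⁻¹ • A) ^ k) y ∈ K := fun k => by
    induction k with
    | zero => exact hy
    | succ k ih =>
      rw [pow_succ']
      exact K.smul_mem (inv_nonneg.2 h0.le) (hA _ ih)
  have hu := (ContinuousLinearMap.apply ℝ E y).hasSum hsum.hasSum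
  have hinv := hsum.one_sub_mul_tsum_pow
  set S := ∑' k : ℕ, (lam⁻¹ • A) ^ k
  refine ⟨lam⁻¹ • S y, K.smul_mem (inv_nonneg.2 h0.le) (mem_of_hasSum hK hmem hu), ?_⟩
  have h1 := congrArg (fun T : E →L[ℝ] E => T y) hinv
  simp only [mul_apply_eq_comp, sub_apply, one_apply_eq_self,
    smul_apply] at h1
  rw [smul_smul, mul_inv_cancel₀ h0.ne', one_smul, map_smul, h1]

/-- Without eigenvectors in a closed cone for eigenvalues in a compact interval, `lam - A` is
bounded below on the cone, uniformly over the interval. -/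
lemma PointedCone.exists_lower_bound [FiniteDimensional ℝ E] {K : PointedCone ℝ E}
    (hK : IsClosed (K : Set E)) (A : E →L[ℝ] E) (a M : ℝ)
    (hne : ∀ lam ∈ Set.Icc a M, ∀ v ∈ K, v ≠ 0 → A v ≠ lam • v) :
    ∃ c > 0, ∀ lam ∈ Set.Icc a M, ∀ u ∈ K, c * ‖u‖ ≤ ‖lam • u - A u‖ := by
  have hcomp : IsCompact (Set.Icc a M ×ˢ (Metric.sphere (0 : E) 1 ∩ (K : Set E))) :=
    isCompact_Icc.prod ((isCompact_sphere 0 1).inter_right hK)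
  obtain ⟨c, hc, hcb⟩ : ∃ c > 0, ∀ p ∈ Set.Icc a M ×ˢ (Metric.sphere (0 : E) 1 ∩ (K : Set E)),
      c ≤ ‖p.1 • p.2 - A p.2‖ := by
    refine hcomp.exists_forall_le' (a := 0) (by fun_prop) ?_
    rintro ⟨l, v⟩ ⟨hl, hv, hvK⟩
    refine norm_pos_iff.2 fun h => hne l hl v hvK ?_ (sub_eq_zero.1 h).symm
    rintro rfl
    simp at hv
  refine ⟨c, hc, fun l hl u hu => ?_⟩
  rcases eq_or_ne u 0 with rfl | hu0
  · simp
  have hn : 0 < ‖u‖ := norm_pos_iff.2 hu0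
  have h1 := hcb (l, ‖u‖⁻¹ • u) ⟨hl, by simp [norm_smul, hn.ne'],
    K.smul_mem (inv_nonneg.2 hn.le) hu⟩
  simp only [map_smul] at h1
  rw [smul_comm, ← smul_sub, norm_smul, norm_inv, norm_norm, inv_mul_eq_div,
    le_div_iff₀ hn] at h1
  exact h1

/-- A Perron–Frobenius theorem for closed convex cones that need not be pointed: if an
`A`-invariant cone contains a point at which some left fixed functional of `A` does not vanish,
then it contains an eigenvector of `A` for an eigenvalue at least `1`. -/
theorem PointedCone.exists_eigenvector_one_le [FiniteDimensional ℝ E] {K : PointedCone ℝ E}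
    (hK : IsClosed (K : Set E)) (A : E →L[ℝ] E) (hA : ∀ u ∈ K, A u ∈ K)
    (φ : E →ₗ[ℝ] ℝ) (hφ : ∀ u, φ (A u) = φ u) {x : E} (hx : x ∈ K) (hφx : φ x ≠ 0) :
    ∃ lam : ℝ, 1 ≤ lam ∧ ∃ v ∈ K, v ≠ 0 ∧ A v = lam • v := by
  by_contra! hne
  have := FiniteDimensional.complete ℝ E
  set M := ‖A‖ + 1
  have hM : 1 ≤ M := le_add_of_nonneg_left (norm_nonneg A)
  obtain ⟨c, hc, hcb⟩ := exists_lower_bound hK A 1 M fun lam hlam => hne lam hlam.1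
  have key : ∀ N : ℕ, ∀ lam ∈ Set.Icc 1 M, M - N * (c / 2) ≤ lam →
      ∀ y ∈ K, ∃ u ∈ K, lam • u - A u = y := fun N => by
    induction N with
    | zero =>
      intro lam hlam h
      refine exists_resolvent_of_norm_lt hK A hA ?_
      have : M ≤ lam := by simpa using h
      exact (lt_add_one _).trans_le this
    | succ N ih =>
      intro lam hlam h
      push_cast at h
      have hmem : min M (lam + c / 2) ∈ Set.Icc 1 M :=
        ⟨le_min hM (by linarith [hlam.1]), min_le_left _ _⟩
      have hN : M - N * (c / 2) ≤ min M (lam + c / 2) :=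
        le_min (by have : 0 ≤ N * (c / 2) := by positivity
                   linarith) (by linarith)
      have := exists_resolvent_sub hK A (δ := min M (lam + c / 2) - lam)
        (sub_nonneg.2 (le_min hlam.2 (by linarith)))
        (by linarith [min_le_right M (lam + c / 2)]) (hcb _ hmem) (ih _ hmem hN)
      simpa only [sub_sub_cancel] using this
  obtain ⟨N, hN⟩ := exists_nat_gt (M / (c / 2))
  rw [div_lt_iff₀ (by positivity)] at hN
  obtain ⟨u, -, hu⟩ := key N 1 ⟨le_rfl, hM⟩ (by linarith) x hx
  apply hφx
  rw [← hu, one_smul, map_sub, hφ, sub_self]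

end ConeEigenvector

lemma hatA_mulVec_snoc {n : ℕ} (A : Matrix (Fin n) (Fin n) ℝ) (b x : Fin n → ℝ) (t : ℝ) :
    (hatA A b).mulVec (Fin.snoc x t : Fin (n + 1) → ℝ) =
      (Fin.snoc (A.mulVec x + t • b) t : Fin (n + 1) → ℝ) := by
  ext i
  refine Fin.lastCases ?_ (fun i => ?_) i
  · simp [hatA, Matrix.mulVec, dotProduct, Fin.sum_univ_castSucc]
  · simp [hatA, Matrix.mulVec, dotProduct, Fin.sum_univ_castSucc, mul_comm]

lemma hatA_mulVec_last {n : ℕ} (A : Matrix (Fin n) (Fin n) ℝ) (b : Fin n → ℝ)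
    (v : Fin (n + 1) → ℝ) : (hatA A b).mulVec v (Fin.last n) = v (Fin.last n) := by
  simp [hatA, Matrix.mulVec, dotProduct, Fin.sum_univ_castSucc]

lemma hatB_mulVec_snoc {m n : ℕ} (B : Matrix (Fin m) (Fin n) ℝ) (η : Fin m → ℝ)
    (x : Fin n → ℝ) (t : ℝ) :
    (hatB B η).mulVec (Fin.snoc x t : Fin (n + 1) → ℝ) =
      (Fin.snoc (B.mulVec x - t • η) t : Fin (m + 1) → ℝ) := by
  ext i
  refine Fin.lastCases ?_ (fun i => ?_) i
  · simp [hatB, Matrix.mulVec, dotProduct, Fin.sum_univ_castSucc]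
  · simp [hatB, Matrix.mulVec, dotProduct, Fin.sum_univ_castSucc, mul_comm, sub_eq_add_neg]

lemma hatA_pow_mulVec_snoc_one {n : ℕ} (A : Matrix (Fin n) (Fin n) ℝ) (b x : Fin n → ℝ) (k : ℕ) :
    (hatA A b ^ k).mulVec (Fin.snoc x 1 : Fin (n + 1) → ℝ) =
      (Fin.snoc ((fun y => A.mulVec y + b)^[k] x) 1 : Fin (n + 1) → ℝ) := by
  induction k with
  | zero => simp
  | succ k ih =>
    rw [pow_succ', ← Matrix.mulVec_mulVec, ih, hatA_mulVec_snoc, Function.iterate_succ_apply',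
      one_smul]

/-- The cone of initial vectors whose whole orbit under `A` satisfies `B v ≥ 0`. -/
def nonescapingCone {ι κ : Type*} [Fintype ι] [DecidableEq ι] (A : Matrix ι ι ℝ)
    (B : Matrix κ ι ℝ) : PointedCone ℝ (ι → ℝ) where
  carrier := {v | ∀ k : ℕ, ∀ j, 0 ≤ B.mulVec ((A ^ k).mulVec v) j}
  add_mem' := fun hu hv k j => by
    simpa only [Matrix.mulVec_add, Pi.add_apply] using add_nonneg (hu k j) (hv k j)
  zero_mem' := fun k j => by simp
  smul_mem' := fun c v hv k j => by
    have h := mul_nonneg c.2 (hv k j)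
    change 0 ≤ B.mulVec ((A ^ k).mulVec ((c : ℝ) • v)) j
    simpa only [Matrix.mulVec_smul, Pi.smul_apply, smul_eq_mul] using h

lemma isClosed_nonescapingCone {ι κ : Type*} [Fintype ι] [DecidableEq ι] (A : Matrix ι ι ℝ)
    (B : Matrix κ ι ℝ) : IsClosed (nonescapingCone A B : Set (ι → ℝ)) := by
  change IsClosed {v | ∀ k : ℕ, ∀ j, 0 ≤ B.mulVec ((A ^ k).mulVec v) j}
  simp only [Set.ofPred_forall]
  refine isClosed_iInter fun k => isClosed_iInter fun j => isClosed_le continuous_const ?_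
  exact (continuous_apply j).comp
    (continuous_const.matrix_mulVec (continuous_const.matrix_mulVec continuous_id))

lemma mulVec_mem_nonescapingCone {ι κ : Type*} [Fintype ι] [DecidableEq ι] {A : Matrix ι ι ℝ}
    {B : Matrix κ ι ℝ} {v : ι → ℝ} (hv : v ∈ nonescapingCone A B) :
    A.mulVec v ∈ nonescapingCone A B := fun k j => by
  rw [Matrix.mulVec_mulVec _ (A ^ k), ← pow_succ]
  exact hv (k + 1) j

/-- If every unit eigenvector `v̂` of the homogenised matrix `Â` for a real eigenvalue
`λ ≥ 1` has some row of `B̂` with `B̂_j v̂ < 0`, then the affine instance `(A, b, B, η)`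
is escaping. -/
theorem affine_escaping_of_eigenvector_condition
    (n m : ℕ) (A : Matrix (Fin n) (Fin n) ℝ) (b : Fin n → ℝ)
    (B : Matrix (Fin m) (Fin n) ℝ) (η : Fin m → ℝ)
    (h : ∀ lam : ℝ, 1 ≤ lam → ∀ vh : Fin (n + 1) → ℝ, (∑ i, vh i ^ 2 = 1) →
      (hatA A b).mulVec vh = lam • vh → ∃ j : Fin (m + 1), (hatB B η).mulVec vh j < 0) :
    ∀ x : Fin n → ℝ, ∃ k : ℕ, ∃ j : Fin m,
      B.mulVec ((fun y => A.mulVec y + b)^[k] x) j ≤ η j := by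
  intro x
  by_contra! hx
  have hxK : (Fin.snoc x 1 : Fin (n + 1) → ℝ) ∈ nonescapingCone (hatA A b) (hatB B η) := by
    intro k j
    rw [hatA_pow_mulVec_snoc_one, hatB_mulVec_snoc]
    refine Fin.lastCases ?_ (fun j => ?_) j
    · simp
    · simpa using (hx k j).le
  obtain ⟨lam, hlam, v, hvK, hv0, hv⟩ := PointedCone.exists_eigenvector_one_le
    (isClosed_nonescapingCone _ _) (hatA A b).mulVecLin.toContinuousLinearMap
    (fun u hu => mulVec_mem_nonescapingCone hu) (LinearMap.proj (Fin.last n))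
    (fun u => hatA_mulVec_last A b u) hxK (by simp)
  replace hv : (hatA A b).mulVec v = lam • v := hv
  have hpos : 0 < ∑ i, v i ^ 2 := by
    obtain ⟨i, hi⟩ := Function.ne_iff.1 hv0
    exact Finset.sum_pos' (fun i _ => sq_nonneg _) ⟨i, Finset.mem_univ i, sq_pos_of_ne_zero hi⟩
  set r := Real.sqrt (∑ i, v i ^ 2)
  have hr : 0 < r := Real.sqrt_pos.2 hpos
  obtain ⟨j, hj⟩ := h lam hlam (r⁻¹ • v)
    (by simp only [Pi.smul_apply, smul_eq_mul, mul_pow, ← Finset.mul_sum, inv_pow]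
        rw [Real.sq_sqrt hpos.le, inv_mul_cancel₀ hpos.ne'])
    (by rw [Matrix.mulVec_smul, hv, smul_comm])
  have hmem := PointedCone.smul_mem _ (inv_nonneg.2 hr.le) hvK 0 j
  rw [pow_zero, Matrix.one_mulVec] at hmem
  exact hj.not_ge hmem
end
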